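/- arXiv:1204.3129 — 2 statements merged into one kernel-verified Lean document; each statement's English description precedes it below -/
import Mathlib

section
/- Let A = {x ∈ ℚ : |x| ≤ 1}. Suppose I ⊆ A satisfies: (i) 0 ∈ I; (ii) a·x ∈ I for all a ∈ I and x ∈ A; (iii) for every c ∈ A, if there are finite families a_1,…,a_n ∈ I and b_1,…,b_m ∈ I with a_1 + ⋯ + a_n + c = b_1 + ⋯ + b_m in ℚ, then c ∈ I. If I contains a nonzero element, then I = A. -/
/-- Let `A = {x ∈ ℚ : |x| ≤ 1}`. If `I ⊆ A` contains `0`, is closed under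
multiplication by elements of `A`, and satisfies the additive ideal condition for the
full rational pre-addition (if `a_1 + ⋯ + a_n + c = b_1 + ⋯ + b_m` in `ℚ` with all
`a_i, b_j ∈ I` and `c ∈ A`, then `c ∈ I`), and `I` contains a nonzero element, then
`I = A`. -/
theorem ideal_of_full_preaddition_blueprint_eq_top (I : Set ℚ)
    (hIA : I ⊆ {x : ℚ | |x| ≤ 1})
    (h0 : (0 : ℚ) ∈ I)
    (hmul : ∀ a ∈ I, ∀ x : ℚ, |x| ≤ 1 → a * x ∈ I)
    (hadd : ∀ c : ℚ, |c| ≤ 1 →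
      (∃ (n m : ℕ) (a : Fin n → ℚ) (b : Fin m → ℚ),
        (∀ i, a i ∈ I) ∧ (∀ j, b j ∈ I) ∧ (∑ i, a i) + c = ∑ j, b j) → c ∈ I)
    (hne : ∃ x ∈ I, x ≠ 0) :
    I = {x : ℚ | |x| ≤ 1} := by
  refine Set.Subset.antisymm hIA fun c hc => ?_
  obtain ⟨x, hx, hx0⟩ := hne
  have hxpos : 0 < |x| := abs_pos.mpr hx0
  obtain ⟨m, hm⟩ := exists_nat_gt (1 / |x|)
  have hmpos : (0 : ℚ) < m := lt_trans (by positivity) hm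
  have hmx : 1 < m * |x| := (div_lt_iff₀ hxpos).mp hm
  have hc1 : |c| ≤ 1 := hc
  have hy : |c / (m * x)| ≤ 1 := by
    rw [abs_div, abs_mul, abs_of_pos hmpos]
    exact (div_le_one (by positivity)).mpr (hc1.trans hmx.le)
  refine hadd c hc1 ⟨0, m, Fin.elim0, fun _ => x * (c / (m * x)), fun i => i.elim0,
    fun _ => hmul x hx _ hy, ?_⟩
  simp only [Finset.univ_eq_empty, Finset.sum_empty, zero_add, Finset.sum_const,
    Finset.card_univ, Fintype.card_fin, nsmul_eq_mul]
  field_simp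
end

section
/- Let A = {x ∈ ℚ : |x| ≤ 1}. A subset I ⊆ A satisfies 0 ∈ I and a·x ∈ I for all a ∈ I, x ∈ A, if and only if I is of one of the following forms: I = {x ∈ ℚ : |x| < r} for some real number r with 0 < r ≤ 1, or I = {x ∈ ℚ : |x| ≤ r} for some rational number r with 0 ≤ r ≤ 1. -/
/-- A set of rationals closed under multiplication by rationals of absolute value at most `1`
is downward closed for the absolute value. -/
theorem mem_of_abs_le_of_mul_mem {I : Set ℚ}
    (hI : ∀ a ∈ I, ∀ x : ℚ, |x| ≤ 1 → a * x ∈ I) {a y : ℚ} (ha : a ∈ I) (hy : |y| ≤ |a|) :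
    y ∈ I := by
  rcases eq_or_ne a 0 with rfl | h0
  · have : y = 0 := by simpa using hy
    rwa [this]
  · have h := hI a ha (y / a) (by rw [abs_div]; exact div_le_one_of_le₀ hy (abs_nonneg a))
    rwa [mul_div_cancel₀ y h0] at h


/-- Let `A = {x ∈ ℚ : |x| ≤ 1}`. A subset `I ⊆ A` contains `0` and is closed under
multiplication by elements of `A` if and only if it is of the form
`{x ∈ ℚ : |x| < r}` for some real `0 < r ≤ 1` or `{x ∈ ℚ : |x| ≤ r}` for some
rational `0 ≤ r ≤ 1`. -/
theorem ideals_of_archimedean_stalk (I : Set ℚ) (hIA : I ⊆ {x : ℚ | |x| ≤ 1}) :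
    ((0 : ℚ) ∈ I ∧ ∀ a ∈ I, ∀ x : ℚ, |x| ≤ 1 → a * x ∈ I) ↔
      ((∃ r : ℝ, 0 < r ∧ r ≤ 1 ∧ I = {x : ℚ | |(x : ℝ)| < r}) ∨
       (∃ r : ℚ, 0 ≤ r ∧ r ≤ 1 ∧ I = {x : ℚ | |x| ≤ r})) := by
  constructor
  · rintro ⟨h0, hI⟩
    by_cases hmax : ∃ a ∈ I, ∀ b ∈ I, |b| ≤ |a|
    · obtain ⟨a, ha, hb⟩ := hmax
      exact Or.inr ⟨|a|, abs_nonneg a, hIA ha,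
        Set.Subset.antisymm hb fun y hy => mem_of_abs_le_of_mul_mem hI ha hy⟩
    · push Not at hmax
      have hle : ∀ x ∈ I, |(x : ℝ)| ≤ 1 := fun x hx => by
        have h : |x| ≤ 1 := hIA hx
        exact_mod_cast h
      have hlub : IsLUB ((fun x : ℚ => |(x : ℝ)|) '' I) (sSup ((fun x : ℚ => |(x : ℝ)|) '' I)) :=
        isLUB_csSup ⟨_, 0, h0, rfl⟩ ⟨1, Set.forall_mem_image.2 hle⟩
      set r := sSup ((fun x : ℚ => |(x : ℝ)|) '' I)
      have hlt : ∀ a ∈ I, |(a : ℝ)| < r := by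
        intro a ha
        obtain ⟨b, hb, hab⟩ := hmax a ha
        have hab' : |(a : ℝ)| < |(b : ℝ)| := by exact_mod_cast hab
        exact hab'.trans_le (hlub.1 ⟨b, hb, rfl⟩)
      refine Or.inl ⟨r, by simpa using hlt 0 h0, hlub.2 (Set.forall_mem_image.2 hle),
        Set.Subset.antisymm hlt fun y hy => ?_⟩
      obtain ⟨_, ⟨a, ha, rfl⟩, hya, -⟩ := hlub.exists_between hy
      have hya' : |(y : ℝ)| ≤ |(a : ℝ)| := hya.le
      exact mem_of_abs_le_of_mul_mem hI ha (by exact_mod_cast hya')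
  · have hmul : ∀ a x : ℚ, |x| ≤ 1 → |a * x| ≤ |a| := fun a x hx => by
      rw [abs_mul]
      exact mul_le_of_le_one_right (abs_nonneg a) hx
    rintro (⟨r, hr, -, rfl⟩ | ⟨r, hr, -, rfl⟩)
    · refine ⟨by simpa using hr, fun a ha x hx => ?_⟩
      have h : |((a * x : ℚ) : ℝ)| ≤ |(a : ℝ)| := by exact_mod_cast hmul a x hx
      exact h.trans_lt ha
    · exact ⟨by simpa using hr, fun a ha x hx => (hmul a x hx).trans ha⟩
end
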